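/- Let F = ℚ(q,a₁,a₂,b₁,b₂,Λ) be the field of rational functions over ℚ in the indeterminates q, a₁, a₂, b₁, b₂, Λ, and let n ∈ ℕ. Define (n+1)×(n+1) matrices over F, indexed by 0 ≤ i, j ≤ n: L_R lower triangular with (L_R)_{ij} = [n−j choose n−i]_{q^{−1}} (−1)^{i−j} q^{−(i−j)(i−j−1)/2} (a₂b₂q^{j};q)_{i−j} / (a₁^{−1}a₂ q^{−(n−2j−1)};q)_{i−j} for i ≥ j and 0 otherwise; D_R diagonal with (D_R)_{jj} = (a₁a₂^{−1}q^{−j};q)_{n−j} (a₂b₁;q)_{j} / ((a₁b₂;q)_{n−j} (a₁^{−1}a₂q^{−(n−j)};q)_{j}); U_R upper triangular with (U_R)_{ij} = [j choose i]_{q^{−1}} (a₁b₁q^{n−j};q)_{j−i} / (a₁a₂^{−1}q^{n−i−j};q)_{j−i} for i ≤ j and 0 otherwise; L_A lower triangular with (L_A)_{ij} = (−1)^{i−j} q^{C(n−i,2)−C(n−j,2)} [n−j choose n−i]_q (a₂b₂q^{j};q)_{i−j} / (Λa₂b₂q^{2j};q)_{i−j} for i ≥ j; D_A diagonal with (D_A)_{jj}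 = a₁^{n−j} a₂^{j} q^{C(j,2)+C(n−j,2)} (Λ;q)_{j} (Λa₂b₂q^{2j};q)_{n−j} / ((Λa₂b₂q^{j−1};q)_{j} (Λa₁a₂b₁b₂q^{n+j−1};q)_{n−j}); U_A upper triangular with (U_A)_{ij} = (−Λa₁^{−1}a₂)^{j−i} q^{C(j,2)−C(i,2)} [j choose i]_q (a₁b₁q^{n−j};q)_{j−i} / (Λa₂b₂q^{2i};q)_{j−i} for i ≤ j; here C(m,2) = m(m−1)/2. Set R := L_R D_R U_R, A := L_A D_A U_A, and let D₂ be the diagonal matrix with (D₂)_{ii} = (Λ q^{n−1})^{i}. Then R D₂ A = A R D₂. -/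

import Mathlib

open Finset

/-- The `q`-shifted factorial `(a;q)_n = ∏_{i=0}^{n-1} (1 - a q^i)`. -/
noncomputable def qPoch {F : Type*} [Field F] (q a : F) (n : ℕ) : F :=
  ∏ i ∈ Finset.range n, (1 - a * q ^ i)

/-- The `q`-binomial coefficient `[m choose k]_q = (q;q)_m/((q;q)_k (q;q)_{m-k})`. -/
noncomputable def qBinom {F : Type*} [Field F] (q : F) (m k : ℕ) : F :=
  qPoch q q m / (qPoch q q k * qPoch q q (m - k))

/-- `C(m,2) = m(m-1)/2`. -/
def C2 (m : ℕ) : ℕ := m * (m - 1) / 2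

noncomputable section ItoMatrices

variable {F : Type*} [Field F]

/-- Lower-triangular factor `L_R` of Ito's matrix `R`. -/
def matLR (q a₁ a₂ b₁ b₂ : F) (n : ℕ) : Matrix (Fin (n + 1)) (Fin (n + 1)) F :=
  fun i j =>
    if (j : ℕ) ≤ (i : ℕ) then
      qBinom q⁻¹ (n - (j : ℕ)) (n - (i : ℕ)) * (-1 : F) ^ ((i : ℕ) - (j : ℕ)) *
        q ^ (-(C2 ((i : ℕ) - (j : ℕ)) : ℤ)) *
        (qPoch q (a₂ * b₂ * q ^ (j : ℕ)) ((i : ℕ) - (j : ℕ)) /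
          qPoch q (a₁⁻¹ * a₂ * q ^ (-((n : ℤ) - 2 * (j : ℕ) - 1))) ((i : ℕ) - (j : ℕ)))
    else 0

/-- Diagonal factor `D_R` of Ito's matrix `R`. -/
def matDR (q a₁ a₂ b₁ b₂ : F) (n : ℕ) : Matrix (Fin (n + 1)) (Fin (n + 1)) F :=
  Matrix.diagonal fun j =>
    qPoch q (a₁ * a₂⁻¹ * q ^ (-(j : ℤ))) (n - (j : ℕ)) * qPoch q (a₂ * b₁) (j : ℕ) /
      (qPoch q (a₁ * b₂) (n - (j : ℕ)) *
        qPoch q (a₁⁻¹ * a₂ * q ^ (-((n : ℤ) - (j : ℕ)))) (j : ℕ))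

/-- Upper-triangular factor `U_R` of Ito's matrix `R`. -/
def matUR (q a₁ a₂ b₁ b₂ : F) (n : ℕ) : Matrix (Fin (n + 1)) (Fin (n + 1)) F :=
  fun i j =>
    if (i : ℕ) ≤ (j : ℕ) then
      qBinom q⁻¹ (j : ℕ) (i : ℕ) *
        (qPoch q (a₁ * b₁ * q ^ (n - (j : ℕ))) ((j : ℕ) - (i : ℕ)) /
          qPoch q (a₁ * a₂⁻¹ * q ^ ((n : ℤ) - (i : ℕ) - (j : ℕ))) ((j : ℕ) - (i : ℕ)))
    else 0

/-- Lower-triangular factor `L_A` of Ito's matrix `A`. -/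
def matLA (q a₁ a₂ b₁ b₂ Λ : F) (n : ℕ) : Matrix (Fin (n + 1)) (Fin (n + 1)) F :=
  fun i j =>
    if (j : ℕ) ≤ (i : ℕ) then
      (-1 : F) ^ ((i : ℕ) - (j : ℕ)) *
        q ^ ((C2 (n - (i : ℕ)) : ℤ) - (C2 (n - (j : ℕ)) : ℤ)) *
        qBinom q (n - (j : ℕ)) (n - (i : ℕ)) *
        (qPoch q (a₂ * b₂ * q ^ (j : ℕ)) ((i : ℕ) - (j : ℕ)) /
          qPoch q (Λ * a₂ * b₂ * q ^ (2 * (j : ℕ))) ((i : ℕ) - (j : ℕ)))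
    else 0

/-- Diagonal factor `D_A` of Ito's matrix `A`. -/
def matDA (q a₁ a₂ b₁ b₂ Λ : F) (n : ℕ) : Matrix (Fin (n + 1)) (Fin (n + 1)) F :=
  Matrix.diagonal fun j =>
    a₁ ^ (n - (j : ℕ)) * a₂ ^ (j : ℕ) * q ^ (C2 (j : ℕ) + C2 (n - (j : ℕ))) *
      (qPoch q Λ (j : ℕ) * qPoch q (Λ * a₂ * b₂ * q ^ (2 * (j : ℕ))) (n - (j : ℕ)) /
        (qPoch q (Λ * a₂ * b₂ * q ^ ((j : ℤ) - 1)) (j : ℕ) *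
          qPoch q (Λ * a₁ * a₂ * b₁ * b₂ * q ^ ((n : ℤ) + (j : ℕ) - 1)) (n - (j : ℕ))))

/-- Upper-triangular factor `U_A` of Ito's matrix `A`. -/
def matUA (q a₁ a₂ b₁ b₂ Λ : F) (n : ℕ) : Matrix (Fin (n + 1)) (Fin (n + 1)) F :=
  fun i j =>
    if (i : ℕ) ≤ (j : ℕ) then
      (-(Λ * a₁⁻¹ * a₂)) ^ ((j : ℕ) - (i : ℕ)) *
        q ^ ((C2 (j : ℕ) : ℤ) - (C2 (i : ℕ) : ℤ)) * qBinom q (j : ℕ) (i : ℕ) *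
        (qPoch q (a₁ * b₁ * q ^ (n - (j : ℕ))) ((j : ℕ) - (i : ℕ)) /
          qPoch q (Λ * a₂ * b₂ * q ^ (2 * (i : ℕ))) ((j : ℕ) - (i : ℕ)))
    else 0

end ItoMatrices

/-- The field `F = ℚ(q,a₁,a₂,b₁,b₂,Λ)` of rational functions over `ℚ`. -/
noncomputable abbrev F7 : Type := FractionRing (MvPolynomial (Fin 6) ℚ)

theorem three_term_linear_part {F : Type*} [Field F] {q K X M u V s d₁ d₂ d₃ d₄ d₆ d₇ : F}
    (hK : K ≠ 0) (hX : X ≠ 0)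
    (h₁ : d₁ ≠ 0) (h₂ : d₂ ≠ 0) (h₃ : d₃ ≠ 0) (h₄ : d₄ ≠ 0) (h₆ : d₆ ≠ 0) (h₇ : d₇ ≠ 0)
    (e₁ : d₁ = 1 - q) (e₂ : d₂ = 1 - q * X) (e₃ : d₃ = 1 - s * (q * K) ^ 2 * X)
    (e₄ : d₄ = 1 - s * (q * K) ^ 2) (e₆ : d₆ = 1 - s * q * K ^ 2) (e₇ : d₇ = 1 - s * K ^ 2) :
    M * u * (q * K * X) + M * s * V * (M / (K * X))
      - (M * s * (1 - q * (q * K * X)) * (q * K * X - V) * (1 - u * (q * K * X)) *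
          (1 - M / (K * X))) / (d₂ * d₃)
    = M * u * (q * K) + M * s * V * (M / K)
      - (M * s * (1 - q * (q * K)) * (q * K - V) * (1 - u * (q * K)) * (1 - M / K)) / (d₁ * d₄)
      + (M * s * (1 - q * K) * (K - V) * (1 - u * K) * (1 - q * M / K)) / (d₁ * d₇)
      - (M * q * K * (u - s * q * K) * (1 - s * V * (q * K)) * (1 - s * q * M * (q * K)) *
          (1 - s * K)) * (1 - X) / (d₆ * d₄ * d₃)
      - (M * s * (1 - q * K) * (K - V) * (1 - u * K) * (1 - q * M / K)) *
          (1 - s * q * K ^ 2 * X) / (d₂ * d₇ * d₆) := by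
  have key : (1 : F) / (d₁ * d₇) - (1 - s * q * K ^ 2 * X) / (d₂ * d₇ * d₆) =
      q * (1 - X) / (d₁ * d₂ * d₆) := by
    field_simp
    subst e₁ e₂ e₆ e₇
    ring
  generalize hc : M * s * (1 - q * K) * (K - V) * (1 - u * K) * (1 - q * M / K) = c
  have : c / (d₁ * d₇) = c * (1 - s * q * K ^ 2 * X) / (d₂ * d₇ * d₆) +
      c * (q * (1 - X) / (d₁ * d₂ * d₆)) := by
    rw [← key]; ring
  rw [this, ← hc]
  clear this key hc c
  field_simp
  subst e₁ e₂ e₃ e₄ e₆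
  ring

section QShifted

variable {F : Type*} [Field F]

theorem qPoch_zero (q a : F) : qPoch q a 0 = 1 := by simp [qPoch]

theorem qPoch_succ (q a : F) (m : ℕ) : qPoch q a (m + 1) = qPoch q a m * (1 - a * q ^ m) := by
  simp [qPoch, Finset.prod_range_succ]

theorem qPoch_succ_left (q a : F) (m : ℕ) :
    qPoch q a (m + 1) = (1 - a) * qPoch q (a * q) m := by
  simp only [qPoch, Finset.prod_range_succ', pow_zero, mul_one]
  rw [mul_comm]
  congr 1
  exact Finset.prod_congr rfl fun i _ => by ring

theorem qPoch_ne_zero {q a : F} {m : ℕ} (h : ∀ i < m, 1 - a * q ^ i ≠ 0) : qPoch q a m ≠ 0 :=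
  Finset.prod_ne_zero_iff.2 fun i hi => h i (Finset.mem_range.1 hi)

/-- The lower triangular kernel `1 / ((q;q)_(i-j) (s q^(2*j);q)_(i-j))`. -/
noncomputable def qKernel (q s : F) (i j : ℕ) : F :=
  if j ≤ i then (qPoch q q (i - j) * qPoch q (s * q ^ (2 * j)) (i - j))⁻¹ else 0

theorem qKernel_self (q s : F) (j : ℕ) : qKernel q s j j = 1 := by
  simp [qKernel, qPoch_zero]

theorem qKernel_of_lt (q s : F) {i j : ℕ} (h : i < j) : qKernel q s i j = 0 := by
  simp [qKernel, h]

theorem qKernel_add (q s : F) (j d : ℕ) :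
    qKernel q s (j + d) j = (qPoch q q d * qPoch q (s * q ^ (2 * j)) d)⁻¹ := by
  simp [qKernel]

theorem qKernel_succ_left {q s : F} {j d : ℕ} (h₁ : 1 - q ^ (d + 1) ≠ 0)
    (h₂ : 1 - s * q ^ (2 * j + d) ≠ 0) :
    qKernel q s (j + d + 1) j * ((1 - q ^ (d + 1)) * (1 - s * q ^ (2 * j + d))) =
      qKernel q s (j + d) j := by
  rw [add_assoc, qKernel_add, qKernel_add, qPoch_succ, qPoch_succ,
    show 1 - q * q ^ d = 1 - q ^ (d + 1) by ring,
    show 1 - s * q ^ (2 * j) * q ^ d = 1 - s * q ^ (2 * j + d) by ring]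
  simp only [mul_inv]
  field_simp

theorem qKernel_succ_right {q s : F} {j d : ℕ} (hq : ∀ k : ℕ, 1 - q ^ (k + 1) ≠ 0)
    (hs : ∀ k : ℕ, 1 - s * q ^ k ≠ 0) :
    qKernel q s (j + d) (j + 1) * (1 - s * q ^ (2 * j + d)) =
      qKernel q s (j + d) j *
        ((1 - q ^ d) * (1 - s * q ^ (2 * j)) * (1 - s * q ^ (2 * j + 1))) := by
  rcases d with _ | e
  · rw [qKernel_of_lt _ _ (by omega)]; simp
  · rw [qKernel_add, show j + (e + 1) = (j + 1) + e by ring, qKernel_add]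
    have A : qPoch q q (e + 1) = qPoch q q e * (1 - q ^ (e + 1)) := by
      rw [qPoch_succ]; ring
    have B : qPoch q (s * q ^ (2 * j)) (e + 1) * (1 - s * q ^ (2 * j + (e + 1))) =
        (1 - s * q ^ (2 * j)) * (1 - s * q ^ (2 * j + 1)) * qPoch q (s * q ^ (2 * (j + 1))) e := by
      have := qPoch_succ q (s * q ^ (2 * j)) (e + 1)
      rw [qPoch_succ_left, qPoch_succ_left] at this
      rw [show s * q ^ (2 * (j + 1)) = s * q ^ (2 * j) * q * q by ring,
        show 1 - s * q ^ (2 * j + (e + 1)) = 1 - s * q ^ (2 * j) * q ^ (e + 1) by ring, ← this]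
      ring
    have h₁ : qPoch q q e ≠ 0 := qPoch_ne_zero fun i _ => by
      rw [show q * q ^ i = q ^ (i + 1) by ring]; exact hq i
    have h₂ : ∀ (a m : ℕ), qPoch q (s * q ^ a) m ≠ 0 := fun a m => qPoch_ne_zero fun i _ => by
      rw [mul_assoc, ← pow_add]; exact hs _
    have h₃ := h₂ (2 * j) (e + 1)
    have h₄ := h₂ (2 * (j + 1)) e
    have h₅ := hq e
    rw [A]
    field_simp
    linear_combination B

end QShifted

section ThreeTerm

variable {F : Type*} [Field F]

/-- Diagonal of the tridiagonal operator, at `N = q ^ n`. -/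
noncomputable def hDiag (q N u v σ τ : F) (i : ℕ) : F :=
  N / q * (u * (σ + τ)) * q ^ i + (1 + (N / q) ^ 2 * (u * σ * τ) * v) * (N / q ^ i)

/-- Superdiagonal of the tridiagonal operator, at `N = q ^ n`. -/
noncomputable def hUp (q N u v σ τ : F) (i : ℕ) : F :=
  -(N / q * (u * σ * τ) * (1 - q ^ (i + 1)) * (q ^ i - v * (N / q)) * (1 - u * q ^ i) *
    (1 - N / q ^ i))

/-- Subdiagonal of the tridiagonal operator, at `N = q ^ n`. -/
noncomputable def hLow (q N : F) (i : ℕ) : F := -(N / q ^ (i + 1))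

/-- Diagonal of the tridiagonal operator transported through `qKernel q (u * σ)`. -/
noncomputable def gDiag (q N u v σ τ : F) (i : ℕ) : F :=
  hDiag q N u v σ τ i + hUp q N u v σ τ i / ((1 - q) * (1 - u * σ * q ^ (2 * i))) -
    (if i = 0 then 0 else hUp q N u v σ τ (i - 1)) /
      ((1 - q) * (1 - u * σ * (q ^ i / q) ^ 2))

/-- Subdiagonal of the tridiagonal operator transported through `qKernel q (u * σ)`. -/
noncomputable def gLow (q N u v σ τ : F) (i : ℕ) : F :=
  -(N / q * τ * q ^ i * (u - u * σ * q ^ i) * (1 - u * σ * v * (N / q) * q ^ i) *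
      (1 - u * σ * N * q ^ i) * (1 - u * σ * q ^ i / q)) /
    ((1 - u * σ * q ^ (2 * i) / q) * (1 - u * σ * q ^ (2 * i)) ^ 2 *
      (1 - u * σ * q ^ (2 * i + 1)))

variable {q N u v σ τ : F}

theorem hUp_pred (hq : q ≠ 0) (j : ℕ) :
    (if j = 0 then 0 else hUp q N u v σ τ (j - 1)) =
      -(N / q * (u * σ * τ) * (1 - q * (q ^ j / q)) * (q ^ j / q - v * (N / q)) *
        (1 - u * (q ^ j / q)) * (1 - N / (q ^ j / q))) := by
  rcases j with _ | j
  · simp [hq]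
  · have : q ^ (j + 1) / q = q ^ j := by field_simp; ring
    rw [this, if_neg (by omega), Nat.add_sub_cancel, hUp, pow_succ']

theorem hLow_mul_qKernel (hq : q ≠ 0) (hq' : ∀ k : ℕ, 1 - q ^ (k + 1) ≠ 0)
    {s : F} (hs : ∀ k : ℕ, 1 - s * q ^ k ≠ 0) (j d : ℕ) :
    (if j + d = 0 then 0 else hLow q N (j + d - 1) * qKernel q s (j + d - 1) j) =
      -(N / q ^ (j + d) * (1 - q ^ d) * (1 - s * q ^ (2 * j) * q ^ d / q)) *
        qKernel q s (j + d) j := by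
  rcases d with _ | e
  · rcases j with _ | j
    · simp
    · simp [qKernel_of_lt]
  · rw [if_neg (by omega), show j + (e + 1) - 1 = j + e by omega,
      ← qKernel_succ_left (hq' e) (hs (2 * j + e)), hLow]
    have : s * q ^ (2 * j) * q ^ (e + 1) / q = s * q ^ (2 * j + e) := by
      field_simp; ring
    rw [this, ← add_assoc]
    ring

theorem hUp_mul_qKernel (hq : q ≠ 0) (hq' : ∀ k : ℕ, 1 - q ^ (k + 1) ≠ 0)
    (hs : ∀ k : ℤ, 1 - u * σ * q ^ k ≠ 0) (j d : ℕ) :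
    (if j = 0 then 0 else hUp q N u v σ τ (j - 1) * qKernel q (u * σ) (j + d) (j - 1)) =
      (if j = 0 then 0 else hUp q N u v σ τ (j - 1)) * (1 - u * σ * q * (q ^ j / q) ^ 2 * q ^ d) /
        ((1 - q ^ (d + 1)) * (1 - u * σ * (q ^ j / q) ^ 2) * (1 - u * σ * q * (q ^ j / q) ^ 2)) *
        qKernel q (u * σ) (j + d) j := by
  rcases j with _ | j
  · simp
  · have hs' : ∀ k : ℕ, 1 - u * σ * q ^ k ≠ 0 := fun k => by simpa using hs k
    have h := qKernel_succ_right (j := j) (d := d + 1) hq' hs'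
    have : q ^ (j + 1) / q = q ^ j := by field_simp; ring
    have h₁ := hq' d
    have h₂ := hs' (2 * j)
    have h₃ := hs' (2 * j + 1)
    rw [if_neg (by omega), if_neg (by omega), Nat.add_sub_cancel, this,
      show u * σ * (q ^ j) ^ 2 = u * σ * q ^ (2 * j) by ring,
      show u * σ * q * (q ^ j) ^ 2 = u * σ * q ^ (2 * j + 1) by ring,
      show u * σ * q ^ (2 * j + 1) * q ^ d = u * σ * q ^ (2 * j + (d + 1)) by ring,
      show j + 1 + d = j + (d + 1) by ring, mul_div_assoc, mul_assoc, mul_assoc]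
    congr 1
    rw [div_mul_eq_mul_div, eq_div_iff (by simp [h₁, h₂, h₃])]
    linear_combination -h

theorem qKernel_three_term_aux (hq : q ≠ 0) (hq' : ∀ k : ℕ, 1 - q ^ (k + 1) ≠ 0)
    (hs : ∀ k : ℤ, 1 - u * σ * q ^ k ≠ 0) (j d : ℕ) :
    hDiag q N u v σ τ (j + d) +
        hUp q N u v σ τ (j + d) / ((1 - q ^ (d + 1)) * (1 - u * σ * q ^ (2 * j + d))) -
        N / q ^ (j + d) * (1 - q ^ d) * (1 - u * σ * q ^ (2 * j) * q ^ d / q) =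
      gDiag q N u v σ τ j +
        gLow q N u v σ τ j * ((1 - q ^ d) * (1 - u * σ * q ^ (2 * j)) *
          (1 - u * σ * q ^ (2 * j + 1)) / (1 - u * σ * q ^ (2 * j + d))) +
        (if j = 0 then 0 else hUp q N u v σ τ (j - 1)) *
          (1 - u * σ * q * (q ^ j / q) ^ 2 * q ^ d) /
          ((1 - q ^ (d + 1)) * (1 - u * σ * (q ^ j / q) ^ 2) *
            (1 - u * σ * q * (q ^ j / q) ^ 2)) := by
  have hz : ∀ k : ℕ, 1 - u * σ * q ^ k ≠ 0 := fun k => by simpa using hs k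
  rw [gDiag, hUp_pred hq, gLow, hUp, hUp, hDiag, hDiag]
  obtain ⟨K, hK⟩ : ∃ K, q ^ j = q * K := ⟨q ^ j / q, by field_simp⟩
  obtain ⟨M, rfl⟩ : ∃ M, N = q * M := ⟨N / q, by field_simp⟩
  have hK₀ : K ≠ 0 := by
    rintro rfl
    exact pow_ne_zero j hq (by simpa using hK)
  have e₁ : q ^ (j + d) = q * K * q ^ d := by rw [pow_add, hK]
  have e₂ : q ^ (j + d + 1) = q * (q * K * q ^ d) := by rw [pow_succ', e₁]
  have e₃ : q ^ (2 * j) = (q * K) ^ 2 := by rw [← hK]; ring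
  have e₄ : q ^ (2 * j + d) = (q * K) ^ 2 * q ^ d := by rw [pow_add, e₃]
  have e₅ : q ^ (2 * j + 1) = (q * K) ^ 2 * q := by rw [pow_succ, e₃]
  have e₆ : q ^ (j + 1) = q * (q * K) := by rw [pow_succ', hK]
  have e₇ : q ^ (d + 1) = q * q ^ d := pow_succ' q d
  have hX : q ^ d ≠ 0 := pow_ne_zero d hq
  have h₁ : 1 - q ≠ 0 := by simpa using hq' 0
  have h₂ : 1 - q * q ^ d ≠ 0 := by rw [← e₇]; exact hq' d
  have h₃ : 1 - u * σ * (q * K) ^ 2 * q ^ d ≠ 0 := by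
    have := hz (2 * j + d); rwa [e₄, ← mul_assoc] at this
  have h₄ : 1 - u * σ * (q * K) ^ 2 ≠ 0 := by rw [← e₃]; exact hz _
  have h₅ : 1 - u * σ * ((q * K) ^ 2 * q) ≠ 0 := by rw [← e₅]; exact hz _
  have hz₂ : q ^ (2 * (j : ℤ)) = (q * K) ^ 2 := by rw [← e₃]; norm_cast
  have h₆ : 1 - u * σ * q * K ^ 2 ≠ 0 := by
    have : u * σ * q * K ^ 2 = u * σ * q ^ (2 * (j : ℤ) - 1) := by
      rw [zpow_sub₀ hq, hz₂, zpow_one]; field_simp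
    rw [this]; exact hs _
  have h₇ : 1 - u * σ * K ^ 2 ≠ 0 := by
    have : u * σ * K ^ 2 = u * σ * q ^ (2 * (j : ℤ) - 2) := by
      rw [zpow_sub₀ hq, hz₂, zpow_ofNat]; field_simp
    rw [this]; exact hs _
  have f₁ : 1 - u * σ * (q * K) ^ 2 / q = 1 - u * σ * q * K ^ 2 := by field_simp
  have f₂ : q * K / q = K := by field_simp
  have f₃ : q * M / q = M := by field_simp
  have key := three_term_linear_part (M := M) (u := u) (V := v * M) hK₀ hX h₁ h₂ h₃ h₄ h₆ h₇
    rfl rfl rfl rfl rfl rfl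
  rw [e₁, e₂, e₃, e₄, e₅, e₆, e₇, hK, f₁, f₂, f₃]
  have f₄ : ∀ a : F, a / ((1 - u * σ * q * K ^ 2) * (1 - u * σ * (q * K) ^ 2) ^ 2 *
      (1 - u * σ * ((q * K) ^ 2 * q))) * ((1 - q ^ d) * (1 - u * σ * (q * K) ^ 2) *
      (1 - u * σ * ((q * K) ^ 2 * q)) / (1 - u * σ * (q * K) ^ 2 * q ^ d)) =
      a * (1 - q ^ d) / ((1 - u * σ * q * K ^ 2) * (1 - u * σ * (q * K) ^ 2) *
        (1 - u * σ * (q * K) ^ 2 * q ^ d)) := fun a => by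
    generalize 1 - u * σ * q * K ^ 2 = d₁ at *
    generalize 1 - u * σ * (q * K) ^ 2 = d₂ at *
    generalize 1 - u * σ * ((q * K) ^ 2 * q) = d₃ at *
    generalize 1 - u * σ * (q * K) ^ 2 * q ^ d = d₄ at *
    field_simp
  have f₅ : u * σ * ((q * K) ^ 2 * q ^ d) = u * σ * (q * K) ^ 2 * q ^ d := by ring
  have f₆ : u * σ * (q * K) ^ 2 * q ^ d / q = u * σ * q * K ^ 2 * q ^ d := by field_simp
  have f₇ : u * σ * (q * K) / q = u * σ * K := by field_simp
  have f₈ : q * M / (q * K * q ^ d) = M / (K * q ^ d) := by field_simp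
  have f₉ : q * M / (q * K) = M / K := by field_simp
  have f₀ : M / (K * q ^ d) * (1 - q ^ d) * (1 - u * σ * q * K ^ 2 * q ^ d) =
      M / (K * q ^ d) - M / K - M * u * σ * (q * K) + M * u * σ * (q * K * q ^ d) := by
    field_simp; ring
  rw [f₅, f₄, f₆, f₇, f₈, f₉, f₀]
  linear_combination τ * key

theorem qKernel_three_term (hq : q ≠ 0) (hq' : ∀ k : ℕ, 1 - q ^ (k + 1) ≠ 0)
    (hs : ∀ k : ℤ, 1 - u * σ * q ^ k ≠ 0) (i j : ℕ) :
    hDiag q N u v σ τ i * qKernel q (u * σ) i j + hUp q N u v σ τ i * qKernel q (u * σ) (i + 1) j +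
        (if i = 0 then 0 else hLow q N (i - 1) * qKernel q (u * σ) (i - 1) j) =
      gDiag q N u v σ τ j * qKernel q (u * σ) i j +
        gLow q N u v σ τ j * qKernel q (u * σ) i (j + 1) +
        (if j = 0 then 0 else hUp q N u v σ τ (j - 1) * qKernel q (u * σ) i (j - 1)) := by
  have hs' : ∀ k : ℕ, 1 - u * σ * q ^ k ≠ 0 := fun k => by simpa using hs k
  rcases lt_or_ge i j with h | h
  · rw [qKernel_of_lt _ _ h, qKernel_of_lt _ _ (show i < j + 1 by omega),
      qKernel_of_lt _ _ (show i - 1 < j by omega), if_neg (show j ≠ 0 by omega)]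
    obtain rfl | h' : j = i + 1 ∨ i + 1 < j := by omega
    · simp [qKernel_self]
    · rw [qKernel_of_lt _ _ h', qKernel_of_lt _ _ (show i < j - 1 by omega)]
      simp
  · obtain ⟨d, rfl⟩ := Nat.exists_eq_add_of_le h
    have h₁ := hq' d
    have h₂ := hs' (2 * j + d)
    rw [hLow_mul_qKernel hq hq' hs', hUp_mul_qKernel hq hq' hs,
      eq_div_of_mul_eq (mul_ne_zero h₁ h₂) (qKernel_succ_left h₁ h₂),
      eq_div_of_mul_eq h₂ (qKernel_succ_right hq' hs')]
    linear_combination qKernel q (u * σ) (j + d) j *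
      qKernel_three_term_aux (N := N) (v := v) (τ := τ) hq hq' hs j d

end ThreeTerm

section Tridiagonal

open Matrix

variable {F : Type*} [Field F]

/-- The tridiagonal matrix with the given diagonal, superdiagonal and subdiagonal. -/
def tridiag (n : ℕ) (d u l : ℕ → F) : Matrix (Fin (n + 1)) (Fin (n + 1)) F := fun i j =>
  if (i : ℕ) = j then d i else if (i : ℕ) + 1 = j then u i else if (i : ℕ) = j + 1 then l j else 0

theorem tridiag_transpose (n : ℕ) (d u l : ℕ → F) :
    (tridiag n d u l)ᵀ = tridiag n d l u := by
  ext i j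
  simp only [transpose_apply, tridiag]
  split_ifs <;> first | omega | rfl | exact congrArg _ (by assumption)

theorem sum_tridiag_mul {n : ℕ} {d u l m : ℕ → F} (i : Fin (n + 1)) (h : u n * m (n + 1) = 0) :
    ∑ k : Fin (n + 1), tridiag n d u l i k * m k =
      d i * m i + u i * m (i + 1) + (if (i : ℕ) = 0 then 0 else l (i - 1) * m (i - 1)) := by
  have key : ∀ k : ℕ, (if (i : ℕ) = k then d i else if (i : ℕ) + 1 = k then u i else
      if (i : ℕ) = k + 1 then l k else 0) * m k =
      (if (i : ℕ) = k then d i * m k else 0) + (if (i : ℕ) + 1 = k then u i * m k else 0) +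
        (if (i : ℕ) = k + 1 then l k * m k else 0) := fun k => by
    split_ifs <;> first | omega | ring
  simp only [tridiag]
  rw [Fin.sum_univ_eq_sum_range (fun k => (if (i : ℕ) = k then d i else
    if (i : ℕ) + 1 = k then u i else if (i : ℕ) = k + 1 then l k else 0) * m k) (n + 1)]
  have hi := i.2
  simp only [key, Finset.sum_add_distrib, Finset.sum_ite_eq, Finset.mem_range, hi, if_true]
  congr 1
  · congr 1
    split_ifs with h'
    · rfl
    · rw [show (i : ℕ) = n by omega, h]
  · rcases hi' : (i : ℕ) with _ | k
    · simp
    · simp only [Nat.add_right_cancel_iff, Finset.sum_ite_eq, Finset.mem_range]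
      rw [if_pos (by omega)]
      simp

theorem tridiag_mul_diagonal {n : ℕ} {d u l D : ℕ → F}
    (h : ∀ i < n, u i * D (i + 1) = D i * l i) :
    tridiag n d u l * diagonal (fun i : Fin (n + 1) => D i) =
      diagonal (fun i : Fin (n + 1) => D i) * (tridiag n d u l)ᵀ := by
  ext i j
  rw [mul_diagonal, diagonal_mul, tridiag_transpose, tridiag, tridiag]
  have hi := i.2
  have hj := j.2
  split_ifs with h₁ h₂ h₃
  · rw [h₁, mul_comm]
  · rw [← h₂]; exact h _ (by omega)
  · rw [h₃]
    linear_combination -h j (by omega)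
  · simp

theorem commute_symmetrized {ι : Type*} [Fintype ι] [DecidableEq ι] {H T G : Matrix ι ι F}
    {D E : ι → F} (hT : H * T = T * G) (hG : G * diagonal D = diagonal D * Gᵀ)
    (hE : Hᵀ * diagonal E = diagonal E * H) :
    Commute H (T * diagonal D * Tᵀ * diagonal E) := by
  have hT' : Tᵀ * Hᵀ = Gᵀ * Tᵀ := by rw [← transpose_mul, hT, transpose_mul]
  calc H * (T * diagonal D * Tᵀ * diagonal E)
      = (H * T) * diagonal D * Tᵀ * diagonal E := by simp only [Matrix.mul_assoc]
    _ = T * (G * diagonal D) * Tᵀ * diagonal E := by rw [hT]; simp only [Matrix.mul_assoc]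
    _ = T * diagonal D * (Gᵀ * Tᵀ) * diagonal E := by rw [hG]; simp only [Matrix.mul_assoc]
    _ = T * diagonal D * Tᵀ * (Hᵀ * diagonal E) := by rw [← hT']; simp only [Matrix.mul_assoc]
    _ = (T * diagonal D * Tᵀ * diagonal E) * H := by rw [hE]; simp only [Matrix.mul_assoc]

/-- A Hessenberg matrix with nonvanishing subdiagonal has the first basis vector as a cyclic
vector. -/
theorem exists_aeval_mulVec_eq {n : ℕ} {H : Matrix (Fin (n + 1)) (Fin (n + 1)) F}
    (h₀ : ∀ i j : Fin (n + 1), (j : ℕ) + 1 < i → H i j = 0)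
    (h₁ : ∀ i j : Fin (n + 1), (i : ℕ) = j + 1 → H i j ≠ 0) (v : Fin (n + 1) → F) :
    ∃ p : Polynomial F, Polynomial.aeval H p *ᵥ Pi.single 0 1 = v := by
  let W : Submodule F (Fin (n + 1) → F) := LinearMap.range
    (((Matrix.mulVecBilin F F).flip (Pi.single (0 : Fin (n + 1)) (1 : F))).comp
      (Polynomial.aeval H).toLinearMap)
  have hW : ∀ {w}, w ∈ W ↔ ∃ p : Polynomial F, Polynomial.aeval H p *ᵥ Pi.single 0 1 = w := by
    intro w; simp [W]
  have hH : ∀ w ∈ W, H *ᵥ w ∈ W := by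
    intro w hw
    obtain ⟨p, rfl⟩ := hW.1 hw
    exact hW.2 ⟨Polynomial.X * p, by rw [map_mul, Polynomial.aeval_X, ← mulVec_mulVec]⟩
  have basis : ∀ m : ℕ, ∀ i : Fin (n + 1), (i : ℕ) = m → Pi.single i 1 ∈ W := by
    intro m
    induction m using Nat.strong_induction_on with
    | _ m ih =>
      intro i hi
      rcases m with _ | m
      · obtain rfl : i = 0 := Fin.ext hi
        exact hW.2 ⟨1, by rw [map_one, one_mulVec]⟩
      · let j : Fin (n + 1) := ⟨m, by omega⟩
        have hj := hH _ (ih m (by omega) j rfl)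
        have hsum : H *ᵥ Pi.single j 1 = ∑ k, H k j • Pi.single k (1 : F) := by
          ext k
          simp [Finset.sum_apply, Pi.single_apply]
        have hrest : ∑ k ∈ Finset.univ.erase i, H k j • Pi.single k (1 : F) ∈ W := by
          refine W.sum_mem fun k hk => ?_
          rcases lt_or_ge (k : ℕ) (m + 1) with h | h
          · exact W.smul_mem _ (ih k h k rfl)
          · have : (k : ℕ) ≠ i := fun e => (Finset.mem_erase.1 hk).1 (Fin.ext e)
            rw [h₀ k j (by simp only [j]; omega), zero_smul]
            exact W.zero_mem
        rw [hsum, ← Finset.add_sum_erase _ _ (Finset.mem_univ i), W.add_mem_iff_left hrest] at hj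
        exact (W.smul_mem_iff (h₁ i j hi)).1 hj
  refine hW.1 ?_
  rw [pi_eq_sum_univ' v]
  exact W.sum_mem fun i _ => W.smul_mem _ (basis i i rfl)

theorem commute_of_commute_hessenberg {n : ℕ} {H A B : Matrix (Fin (n + 1)) (Fin (n + 1)) F}
    (h₀ : ∀ i j : Fin (n + 1), (j : ℕ) + 1 < i → H i j = 0)
    (h₁ : ∀ i j : Fin (n + 1), (i : ℕ) = j + 1 → H i j ≠ 0)
    (hA : Commute H A) (hB : Commute H B) : Commute A B := by
  have aux : ∀ {M : Matrix (Fin (n + 1)) (Fin (n + 1)) F} (p : Polynomial F), Commute H M →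
      Commute (Polynomial.aeval H p) M := fun p hM => by
    induction p using Polynomial.induction_on' with
    | add p q hp hq => simpa using hp.add_left hq
    | monomial k a =>
      rw [Polynomial.aeval_monomial]
      exact (Algebra.commute_algebraMap_left a _).mul_left (hM.pow_left k)
  obtain ⟨p, hp⟩ := exists_aeval_mulVec_eq h₀ h₁ (A *ᵥ Pi.single 0 1)
  have : Polynomial.aeval H p = A := by
    refine Matrix.mulVec_injective (funext fun v => ?_)
    obtain ⟨r, rfl⟩ := exists_aeval_mulVec_eq h₀ h₁ v
    have hr := congrArg (· *ᵥ Pi.single (0 : Fin (n + 1)) (1 : F)) (aux r hA).eq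
    simp only [← mulVec_mulVec, ← hp] at hr
    rw [← hr, mulVec_mulVec, mulVec_mulVec, ← map_mul, ← map_mul, mul_comm]
  exact this ▸ aux p hB

end Tridiagonal

section Commutant

open Matrix

variable {F : Type*} [Field F]

/-- The kernel `qKernel` as a matrix. -/
noncomputable def qKernelMatrix (n : ℕ) (q s : F) : Matrix (Fin (n + 1)) (Fin (n + 1)) F :=
  fun i j => qKernel q s i j

theorem commute_tridiag_symmetrized {n : ℕ} {q u v σ τ : F} {D E : ℕ → F} (hq : q ≠ 0)
    (hq' : ∀ k : ℕ, 1 - q ^ (k + 1) ≠ 0) (hs : ∀ k : ℤ, 1 - u * σ * q ^ k ≠ 0)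
    (hD : ∀ i < n, hUp q (q ^ n) u v σ τ i * D (i + 1) = D i * gLow q (q ^ n) u v σ τ i)
    (hE : ∀ i < n, hLow q (q ^ n) i * E (i + 1) = E i * hUp q (q ^ n) u v σ τ i) :
    Commute (tridiag n (hDiag q (q ^ n) u v σ τ) (hUp q (q ^ n) u v σ τ) (hLow q (q ^ n)))
      (qKernelMatrix n q (u * σ) * diagonal (fun i : Fin (n + 1) => D i) *
        (qKernelMatrix n q (u * σ))ᵀ * diagonal (fun i : Fin (n + 1) => E i)) := by
  refine commute_symmetrized (G := tridiag n (gDiag q (q ^ n) u v σ τ) (hUp q (q ^ n) u v σ τ)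
    (gLow q (q ^ n) u v σ τ)) ?_ (tridiag_mul_diagonal hD) ?_
  · ext i j
    have hG : ∀ k : Fin (n + 1), qKernel q (u * σ) i k *
        tridiag n (gDiag q (q ^ n) u v σ τ) (hUp q (q ^ n) u v σ τ) (gLow q (q ^ n) u v σ τ) k j =
        tridiag n (gDiag q (q ^ n) u v σ τ) (gLow q (q ^ n) u v σ τ) (hUp q (q ^ n) u v σ τ) j k *
          qKernel q (u * σ) i k := fun k => by
      rw [← tridiag_transpose, transpose_apply, mul_comm]
    simp only [mul_apply, qKernelMatrix, hG]
    rw [sum_tridiag_mul (m := fun k => qKernel q (u * σ) k j) i,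
      sum_tridiag_mul (m := fun k => qKernel q (u * σ) i k) j, qKernel_three_term hq hq' hs]
    · rw [qKernel_of_lt _ _ i.2, mul_zero]
    · simp [hUp, div_self (pow_ne_zero n hq)]
  · rw [tridiag_transpose, tridiag_mul_diagonal hE, tridiag_transpose]

theorem hDiag_comm (q N u v σ τ : F) : hDiag q N u v σ τ = hDiag q N u v τ σ := by
  ext i
  simp only [hDiag]
  ring

theorem hUp_comm (q N u v σ τ : F) : hUp q N u v σ τ = hUp q N u v τ σ := by
  ext i
  simp only [hUp]
  ring

theorem commute_of_conj_diagonal {ι : Type*} [Fintype ι] [DecidableEq ι] {S S' : Matrix ι ι F}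
    {α δ E : ι → F} (h : ∀ i, δ i * α i = E i) (h₀ : ∀ i, E i ≠ 0)
    (hS : Commute (S * diagonal E) (S' * diagonal E)) :
    Commute (diagonal α * S * diagonal δ) (diagonal α * S' * diagonal δ) := by
  have hE : diagonal δ * diagonal α = diagonal E := by
    rw [diagonal_mul_diagonal]
    exact congrArg diagonal (funext h)
  have hE' : diagonal E * diagonal E⁻¹ = 1 := by
    rw [diagonal_mul_diagonal, ← diagonal_one]
    exact congrArg diagonal (funext fun i => mul_inv_cancel₀ (h₀ i))
  have key : S * diagonal E * S' = S' * diagonal E * S := by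
    have := congrArg (· * diagonal E⁻¹) hS.eq
    simpa only [Matrix.mul_assoc, hE', Matrix.mul_one] using this
  calc diagonal α * S * diagonal δ * (diagonal α * S' * diagonal δ)
      = diagonal α * (S * (diagonal δ * diagonal α) * S') * diagonal δ := by
        simp only [Matrix.mul_assoc]
    _ = diagonal α * (S' * (diagonal δ * diagonal α) * S) * diagonal δ := by rw [hE, key]
    _ = diagonal α * S' * diagonal δ * (diagonal α * S * diagonal δ) := by
        simp only [Matrix.mul_assoc]

theorem commute_of_symmetrized {n : ℕ} {q u v σ τ : F} {α δ D D' : ℕ → F} (hq : q ≠ 0)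
    (hq' : ∀ k : ℕ, 1 - q ^ (k + 1) ≠ 0) (hσ : ∀ k : ℤ, 1 - u * σ * q ^ k ≠ 0)
    (hτ : ∀ k : ℤ, 1 - u * τ * q ^ k ≠ 0) (hα : ∀ i ≤ n, α i ≠ 0) (hδ : ∀ i ≤ n, δ i ≠ 0)
    (hD : ∀ i < n, hUp q (q ^ n) u v σ τ i * D (i + 1) = D i * gLow q (q ^ n) u v σ τ i)
    (hD' : ∀ i < n, hUp q (q ^ n) u v τ σ i * D' (i + 1) = D' i * gLow q (q ^ n) u v τ σ i)
    (hE : ∀ i < n, hLow q (q ^ n) i * (δ (i + 1) * α (i + 1)) =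
      δ i * α i * hUp q (q ^ n) u v σ τ i) :
    Commute
      (diagonal (fun i : Fin (n + 1) => α i) * (qKernelMatrix n q (u * σ) *
        diagonal (fun i : Fin (n + 1) => D i) * (qKernelMatrix n q (u * σ))ᵀ) *
          diagonal (fun i : Fin (n + 1) => δ i))
      (diagonal (fun i : Fin (n + 1) => α i) * (qKernelMatrix n q (u * τ) *
        diagonal (fun i : Fin (n + 1) => D' i) * (qKernelMatrix n q (u * τ))ᵀ) *
          diagonal (fun i : Fin (n + 1) => δ i)) := by
  refine commute_of_conj_diagonal (E := fun i : Fin (n + 1) => δ i * α i) (fun _ => rfl)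
    (fun i => mul_ne_zero (hδ i (by omega)) (hα i (by omega))) ?_
  refine commute_of_commute_hessenberg
    (H := tridiag n (hDiag q (q ^ n) u v σ τ) (hUp q (q ^ n) u v σ τ) (hLow q (q ^ n)))
    (fun i j h => ?_) (fun i j h => ?_)
    (commute_tridiag_symmetrized (E := fun i => δ i * α i) hq hq' hσ hD hE) ?_
  · rw [tridiag, if_neg (by omega), if_neg (by omega), if_neg (by omega)]
  · rw [tridiag, if_neg (by omega), if_neg (by omega), if_pos h, hLow]
    exact neg_ne_zero.2 (div_ne_zero (pow_ne_zero _ hq) (pow_ne_zero _ hq))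
  · rw [hDiag_comm, hUp_comm]
    refine commute_tridiag_symmetrized (E := fun i => δ i * α i) hq hq' hτ hD' fun i hi => ?_
    rw [hUp_comm]
    exact hE i hi

end Commutant

section Factorization

variable {F : Type*} [Field F]

theorem C2_succ (m : ℕ) : C2 (m + 1) = C2 m + m := by
  simp only [C2, ← Nat.choose_two_right, Nat.choose_succ_succ' m 1, Nat.choose_one_right,
    add_comm]

theorem C2_add (m k : ℕ) : C2 (m + k) = C2 m + C2 k + m * k := by
  induction k with
  | zero => simp [C2]
  | succ k ih => rw [← add_assoc, C2_succ, C2_succ, ih]; ring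

theorem qPoch_add (q a : F) (m k : ℕ) :
    qPoch q a (m + k) = qPoch q a m * qPoch q (a * q ^ m) k := by
  simp only [qPoch, Finset.prod_range_add, pow_add, mul_assoc]

theorem qPoch_reverse {q a : F} (hq : q ≠ 0) (ha : a ≠ 0) (m : ℕ) :
    qPoch q (a⁻¹ * (q ^ m)⁻¹) m = (-a⁻¹) ^ m * (q ^ (C2 m + m))⁻¹ * qPoch q (a * q) m := by
  obtain ⟨b, rfl⟩ : ∃ b, a = b⁻¹ := ⟨a⁻¹, (inv_inv a).symm⟩
  have hb : b ≠ 0 := fun h => ha (by rw [h, inv_zero])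
  rw [inv_inv]
  induction m with
  | zero => simp [qPoch_zero, C2]
  | succ m ih =>
    rw [qPoch_succ_left, qPoch_succ, C2_succ,
      show b * (q ^ (m + 1))⁻¹ * q = b * (q ^ m)⁻¹ by field_simp; ring, ih]
    field_simp
    ring

theorem qPoch_inv {q : F} (hq : q ≠ 0) (m : ℕ) :
    qPoch q⁻¹ q⁻¹ m = (-1) ^ m * (q ^ (C2 m + m))⁻¹ * qPoch q q m := by
  induction m with
  | zero => simp [qPoch_zero, C2]
  | succ m ih =>
    rw [qPoch_succ, qPoch_succ, C2_succ, ih]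
    simp only [inv_pow]
    field_simp
    ring

theorem qBinom_inv {q : F} (hq : q ≠ 0) (m k : ℕ) :
    qBinom q⁻¹ (m + k) m = (q ^ (m * k))⁻¹ * qBinom q (m + k) m := by
  rw [qBinom, qBinom, qPoch_inv hq, qPoch_inv hq, qPoch_inv hq, Nat.add_sub_cancel_left, C2_add]
  have h : (-1 : F) ^ m ≠ 0 := by simp
  have h' : (-1 : F) ^ k ≠ 0 := by simp
  rw [pow_add]
  field_simp
  ring

/-- Row scaling of the lower triangular factors. -/
noncomputable def lowerScale (q u : F) (n i : ℕ) : F :=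
  (-1) ^ i * q ^ C2 (n - i) * qPoch q u i / qPoch q q (n - i)

/-- Column scaling of the upper triangular factors. -/
noncomputable def upperScale (q v x : F) (n j : ℕ) : F :=
  x ^ j * q ^ C2 j * qPoch q q j / qPoch q v (n - j)

variable {q : F}

theorem lowerScale_mul_qKernel {u s : F} {n j d m : ℕ} (hq : q ≠ 0)
    (hq' : ∀ k, qPoch q q k ≠ 0) (hu : ∀ k, qPoch q u k ≠ 0) (hn : n = j + d + m) :
    lowerScale q u n (j + d) * qKernel q s (j + d) j * (lowerScale q u n j)⁻¹ =
      (-1) ^ d * (q ^ (m * d + C2 d))⁻¹ * qBinom q (m + d) m *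
        (qPoch q (u * q ^ j) d / qPoch q (s * q ^ (2 * j)) d) := by
  rw [qKernel, if_pos (by omega), lowerScale, lowerScale, qBinom, qPoch_add q u,
    show n - (j + d) = m by omega, show n - j = m + d by omega, Nat.add_sub_cancel_left,
    Nat.add_sub_cancel_left, C2_add m d]
  have := hq' m
  have := hq' d
  have := hq' (m + d)
  have := hu j
  have h : (-1 : F) ^ j ≠ 0 := by simp
  by_cases h' : qPoch q (s * q ^ (2 * j)) d = 0
  · simp [h']
  field_simp
  ring

theorem upperScale_mul_qKernel {v x s : F} {n i d m : ℕ} (hq : q ≠ 0) (hx : x ≠ 0)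
    (hq' : ∀ k, qPoch q q k ≠ 0) (hv : ∀ k, qPoch q v k ≠ 0) (hn : n = i + d + m) :
    (upperScale q v x n i)⁻¹ * qKernel q s (i + d) i * upperScale q v x n (i + d) =
      x ^ d * q ^ (C2 d + i * d) * qBinom q (i + d) i *
        (qPoch q (v * q ^ m) d / qPoch q (s * q ^ (2 * i)) d) := by
  have hm := hv m
  have hmd := hv (m + d)
  rw [qKernel, if_pos (by omega), upperScale, upperScale, qBinom,
    show n - (i + d) = m by omega, show n - i = m + d by omega, Nat.add_sub_cancel_left,
    C2_add i d]
  rw [qPoch_add q v] at hmd ⊢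
  have := hq' i
  have := hq' d
  have := right_ne_zero_of_mul hmd
  by_cases h' : qPoch q (s * q ^ (2 * i)) d = 0
  · simp [h']
  field_simp
  ring

theorem hLow_mul_scale_succ {u v σ τ : F} {n i : ℕ} (hq : q ≠ 0)
    (hq' : ∀ k, qPoch q q k ≠ 0) (hv : ∀ k, qPoch q v k ≠ 0) (hi : i < n) :
    hLow q (q ^ n) i * (upperScale q v (-(q ^ n / q * (u * σ * τ))) n (i + 1) *
        lowerScale q u n (i + 1)) =
      upperScale q v (-(q ^ n / q * (u * σ * τ))) n i * lowerScale q u n i *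
        hUp q (q ^ n) u v σ τ i := by
  obtain ⟨m, rfl⟩ := Nat.exists_eq_add_of_lt hi
  have h₁ := hq' m
  have h₂ := hq' (m + 1)
  have h₃ := hv m
  have h₄ := hv (m + 1)
  rw [upperScale, upperScale, lowerScale, lowerScale, hLow, hUp,
    show i + m + 1 - (i + 1) = m by omega, show i + m + 1 - i = m + 1 by omega,
    C2_succ, C2_succ]
  rw [qPoch_succ] at h₂ h₄
  rw [show q ^ (i + m + 1) / q = q ^ i * q ^ m by field_simp; ring, pow_succ (-_) i]
  generalize (-(q ^ i * q ^ m * (u * σ * τ))) ^ i = y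
  have h₅ := right_ne_zero_of_mul h₂
  have h₆ := right_ne_zero_of_mul h₄
  have hX := pow_ne_zero m hq
  have hY := pow_ne_zero i hq
  simp only [qPoch_succ, pow_add, pow_one]
  generalize q ^ m = X at *
  generalize q ^ i = Y at *
  obtain ⟨d, hd⟩ : ∃ d, d = 1 - q * X := ⟨_, rfl⟩
  obtain ⟨e, he⟩ : ∃ e, e = 1 - v * X := ⟨_, rfl⟩
  rw [← hd] at h₅ ⊢
  rw [← he] at h₆ ⊢
  field_simp
  rw [hd, he]
  ring

end Factorization

section ItoFactorization

open Matrix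

variable {F : Type*} [Field F] {q a₁ a₂ b₁ b₂ Λ : F} {n : ℕ}

theorem diagonal_mul_qKernelMatrix_mul_diagonal_apply (s : F) (α β : ℕ → F) (i j : Fin (n + 1)) :
    (diagonal (fun k : Fin (n + 1) => α k) * qKernelMatrix n q s *
      diagonal (fun k : Fin (n + 1) => β k)) i j = α i * qKernel q s i j * β j := by
  rw [mul_diagonal, diagonal_mul, qKernelMatrix]

theorem diagonal_mul_qKernelMatrix_transpose_mul_diagonal_apply (s : F) (α β : ℕ → F)
    (i j : Fin (n + 1)) :
    (diagonal (fun k : Fin (n + 1) => α k) * (qKernelMatrix n q s)ᵀ *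
      diagonal (fun k : Fin (n + 1) => β k)) i j = α i * qKernel q s j i * β j := by
  rw [mul_diagonal, diagonal_mul, transpose_apply, qKernelMatrix]

theorem matLA_eq (hq : q ≠ 0) (hq' : ∀ k, qPoch q q k ≠ 0) (hu : ∀ k, qPoch q (a₂ * b₂) k ≠ 0) :
    matLA q a₁ a₂ b₁ b₂ Λ n =
      diagonal (fun i : Fin (n + 1) => lowerScale q (a₂ * b₂) n i) *
        qKernelMatrix n q (a₂ * b₂ * Λ) *
        diagonal (fun i : Fin (n + 1) => (lowerScale q (a₂ * b₂) n i)⁻¹) := by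
  ext i j
  rw [diagonal_mul_qKernelMatrix_mul_diagonal_apply _ (lowerScale q (a₂ * b₂) n)
    (fun i => (lowerScale q (a₂ * b₂) n i)⁻¹), matLA]
  split_ifs with h
  · obtain ⟨d, hd⟩ := Nat.exists_eq_add_of_le h
    obtain ⟨m, hm⟩ := Nat.exists_eq_add_of_le (show j + d ≤ n by omega)
    rw [hd, lowerScale_mul_qKernel hq hq' hu hm, show n - (j + d) = m by omega,
      show n - (j : ℕ) = m + d by omega, Nat.add_sub_cancel_left, C2_add,
      show ((C2 m : ℕ) : ℤ) - (C2 m + C2 d + m * d : ℕ) = -((m * d + C2 d : ℕ) : ℤ) by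
        push_cast; ring, _root_.zpow_neg, zpow_natCast, show Λ * a₂ * b₂ = a₂ * b₂ * Λ by ring]
  · rw [qKernel_of_lt _ _ (by omega), mul_zero, zero_mul]

theorem matUA_eq (hq : q ≠ 0) (hx : Λ * a₁⁻¹ * a₂ ≠ 0) (hq' : ∀ k, qPoch q q k ≠ 0)
    (hv : ∀ k, qPoch q (a₁ * b₁) k ≠ 0) :
    matUA q a₁ a₂ b₁ b₂ Λ n =
      diagonal (fun i : Fin (n + 1) =>
        (upperScale q (a₁ * b₁) (-(Λ * a₁⁻¹ * a₂)) n i)⁻¹) *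
        (qKernelMatrix n q (a₂ * b₂ * Λ))ᵀ *
        diagonal (fun i : Fin (n + 1) => upperScale q (a₁ * b₁) (-(Λ * a₁⁻¹ * a₂)) n i) := by
  ext i j
  rw [diagonal_mul_qKernelMatrix_transpose_mul_diagonal_apply _
    (fun i => (upperScale q (a₁ * b₁) (-(Λ * a₁⁻¹ * a₂)) n i)⁻¹)
    (upperScale q (a₁ * b₁) (-(Λ * a₁⁻¹ * a₂)) n), matUA]
  split_ifs with h
  · obtain ⟨d, hd⟩ := Nat.exists_eq_add_of_le h
    obtain ⟨m, hm⟩ := Nat.exists_eq_add_of_le (show i + d ≤ n by omega)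
    rw [hd, upperScale_mul_qKernel hq (neg_ne_zero.2 hx) hq' hv hm,
      show n - (i + d) = m by omega, Nat.add_sub_cancel_left, C2_add,
      show ((C2 i + C2 d + i * d : ℕ) : ℤ) - (C2 i : ℕ) = (C2 d + i * d : ℕ) by
        push_cast; ring, zpow_natCast, show Λ * a₂ * b₂ = a₂ * b₂ * Λ by ring]
  · rw [qKernel_of_lt _ _ (by omega), mul_zero, zero_mul]

theorem matLR_eq {σ : F} (hq : q ≠ 0) (hq' : ∀ k, qPoch q q k ≠ 0)
    (hu : ∀ k, qPoch q (a₂ * b₂) k ≠ 0) (hσ : a₂ * b₂ * σ = a₁⁻¹ * a₂ * (q / q ^ n)) :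
    matLR q a₁ a₂ b₁ b₂ n =
      diagonal (fun i : Fin (n + 1) => lowerScale q (a₂ * b₂) n i) *
        qKernelMatrix n q (a₂ * b₂ * σ) *
        diagonal (fun i : Fin (n + 1) => (lowerScale q (a₂ * b₂) n i)⁻¹) := by
  ext i j
  rw [diagonal_mul_qKernelMatrix_mul_diagonal_apply _ (lowerScale q (a₂ * b₂) n)
    (fun i => (lowerScale q (a₂ * b₂) n i)⁻¹), matLR]
  split_ifs with h
  · obtain ⟨d, hd⟩ := Nat.exists_eq_add_of_le h
    obtain ⟨m, hm⟩ := Nat.exists_eq_add_of_le (show j + d ≤ n by omega)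
    have e : a₁⁻¹ * a₂ * q ^ (-((n : ℤ) - 2 * (j : ℕ) - 1)) = a₂ * b₂ * σ * q ^ (2 * (j : ℕ)) := by
      rw [hσ, show -((n : ℤ) - 2 * (j : ℕ) - 1) = 1 - n + (2 * (j : ℕ) : ℕ) by push_cast; ring,
        zpow_add₀ hq, zpow_sub₀ hq, zpow_one, zpow_natCast, zpow_natCast]
      ring
    rw [e, hd, lowerScale_mul_qKernel hq hq' hu hm, show n - (j + d) = m by omega,
      show n - (j : ℕ) = m + d by omega, Nat.add_sub_cancel_left, qBinom_inv hq, _root_.zpow_neg,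
      zpow_natCast, pow_add, mul_inv]
    ring
  · rw [qKernel_of_lt _ _ (by omega), mul_zero, zero_mul]

theorem matUR_eq {σ : F} (hq : q ≠ 0) (hc : a₁⁻¹ * a₂ ≠ 0) (hq' : ∀ k, qPoch q q k ≠ 0)
    (hv : ∀ k, qPoch q (a₁ * b₁) k ≠ 0) (hσ : a₂ * b₂ * σ = a₁⁻¹ * a₂ * (q / q ^ n)) :
    matUR q a₁ a₂ b₁ b₂ n =
      diagonal (fun i : Fin (n + 1) => (upperScale q (a₁ * b₁) (-(a₂ * b₂ * σ)) n i)⁻¹) *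
        (qKernelMatrix n q (a₂ * b₂ * σ))ᵀ *
        diagonal (fun i : Fin (n + 1) => upperScale q (a₁ * b₁) (-(a₂ * b₂ * σ)) n i) := by
  have hs : a₂ * b₂ * σ ≠ 0 := by
    rw [hσ]
    exact mul_ne_zero hc (div_ne_zero hq (pow_ne_zero n hq))
  ext i j
  rw [diagonal_mul_qKernelMatrix_transpose_mul_diagonal_apply _
    (fun i => (upperScale q (a₁ * b₁) (-(a₂ * b₂ * σ)) n i)⁻¹)
    (upperScale q (a₁ * b₁) (-(a₂ * b₂ * σ)) n), matUR]
  split_ifs with h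
  · obtain ⟨d, hd⟩ := Nat.exists_eq_add_of_le h
    obtain ⟨m, hm⟩ := Nat.exists_eq_add_of_le (show i + d ≤ n by omega)
    have hn : q ^ n = q ^ (i + d + m) := by rw [← hm]
    have e : a₁ * a₂⁻¹ * q ^ ((n : ℤ) - (i : ℕ) - (i + d : ℕ)) =
        (a₂ * b₂ * σ * q ^ (2 * (i : ℕ)) / q)⁻¹ * (q ^ d)⁻¹ := by
      rw [hσ, show (n : ℤ) - (i : ℕ) - (i + d : ℕ) = m - (i : ℕ) by omega,
        zpow_sub₀ hq, zpow_natCast, zpow_natCast, hn]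
      have h₁ := left_ne_zero_of_mul hc
      have h₂ := right_ne_zero_of_mul hc
      have h₁' := inv_ne_zero h₁
      rw [inv_inv] at h₁'
      field_simp
      ring
    have ha : a₂ * b₂ * σ * q ^ (2 * (i : ℕ)) / q ≠ 0 :=
      div_ne_zero (mul_ne_zero hs (pow_ne_zero _ hq)) hq
    rw [hd, upperScale_mul_qKernel hq (neg_ne_zero.2 hs) hq' hv hm,
      show n - (i + d) = m by omega, Nat.add_sub_cancel_left, e, qPoch_reverse hq ha,
      div_mul_cancel₀ _ hq, qBinom_inv hq]
    generalize qPoch q (a₂ * b₂ * σ * q ^ (2 * (i : ℕ))) d = p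
    generalize a₂ * b₂ * σ = s at *
    simp only [neg_pow (_)⁻¹, neg_pow s, inv_pow, div_pow, mul_pow, pow_add]
    have h₁ : (-1 : F) ^ d ≠ 0 := by simp
    have h₂ : ((-1 : F) ^ d) ^ 2 = 1 := by rw [← pow_mul, mul_comm, pow_mul]; simp
    field_simp
    rw [h₂]
    ring
  · rw [qKernel_of_lt _ _ (by omega), mul_zero, zero_mul]

end ItoFactorization

section DiagonalRatios

variable {F : Type*} [Field F]

theorem qPoch_shift (q a : F) (m : ℕ) :
    (1 - a) * qPoch q (a * q) m = qPoch q a m * (1 - a * q ^ m) := by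
  rw [← qPoch_succ_left, qPoch_succ]

/-- Diagonal entries of Ito's matrix `A`. -/
noncomputable def diagA (q a₁ a₂ b₁ b₂ Λ : F) (n j : ℕ) : F :=
  a₁ ^ (n - j) * a₂ ^ j * q ^ (C2 j + C2 (n - j)) *
    (qPoch q Λ j * qPoch q (Λ * a₂ * b₂ * q ^ (2 * j)) (n - j) /
      (qPoch q (Λ * a₂ * b₂ * q ^ ((j : ℤ) - 1)) j *
        qPoch q (Λ * a₁ * a₂ * b₁ * b₂ * q ^ ((n : ℤ) + j - 1)) (n - j)))

/-- Diagonal entries of Ito's matrix `R`. -/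
noncomputable def diagR (q a₁ a₂ b₁ b₂ : F) (n j : ℕ) : F :=
  qPoch q (a₁ * a₂⁻¹ * q ^ (-(j : ℤ))) (n - j) * qPoch q (a₂ * b₁) j /
    (qPoch q (a₁ * b₂) (n - j) * qPoch q (a₁⁻¹ * a₂ * q ^ (-((n : ℤ) - j))) j)

variable {q a₁ a₂ b₁ b₂ Λ : F} {n : ℕ}

theorem qPoch_zpow_pred_succ {s : F} (hq : q ≠ 0) (hs : ∀ k : ℤ, 1 - s * q ^ k ≠ 0) (i : ℕ) :
    qPoch q (s * q ^ i) (i + 1) =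
      qPoch q (s * q ^ i / q) i * ((1 - s * q ^ (2 * i) / q) * (1 - s * q ^ (2 * i))) /
        (1 - s * q ^ i / q) := by
  have h : 1 - s * q ^ i / q ≠ 0 := by
    have := hs (i - 1)
    rwa [zpow_sub_one₀ hq, zpow_natCast, ← div_eq_mul_inv, ← mul_div_assoc] at this
  rw [eq_div_iff h, mul_comm]
  have := qPoch_shift q (s * q ^ i / q) (i + 1)
  rw [div_mul_cancel₀ _ hq] at this
  rw [this, qPoch_succ]
  field_simp
  ring

theorem qPoch_sq_succ {s : F} (hs : ∀ k : ℤ, 1 - s * q ^ k ≠ 0) (i m : ℕ) :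
    qPoch q (s * q ^ (2 * (i + 1))) m = qPoch q (s * q ^ (2 * i)) (m + 1) *
      (1 - s * q ^ (i + m + 1) * q ^ i) /
        ((1 - s * q ^ (2 * i)) * (1 - s * q ^ (2 * i + 1))) := by
  have h₁ : 1 - s * q ^ (2 * i) ≠ 0 := by exact_mod_cast hs (2 * i : ℕ)
  have h₂ : 1 - s * q ^ (2 * i + 1) ≠ 0 := by exact_mod_cast hs (2 * i + 1 : ℕ)
  rw [eq_div_iff (mul_ne_zero h₁ h₂), qPoch_succ_left]
  have := qPoch_shift q (s * q ^ (2 * i) * q) m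
  rw [show s * q ^ (2 * (i + 1)) = s * q ^ (2 * i) * q * q by ring]
  linear_combination (1 - s * q ^ (2 * i)) * this

theorem hLow_mul_diagA_succ {i : ℕ} {τ : F} (hq : q ≠ 0) (ha₁ : a₁ ≠ 0)
    (hs : ∀ k : ℤ, 1 - a₂ * b₂ * Λ * q ^ k ≠ 0)
    (ht : ∀ k : ℤ, 1 - Λ * a₁ * a₂ * b₁ * b₂ * q ^ k ≠ 0)
    (hτ : q ^ n / q * (a₂ * b₂ * τ) = a₁⁻¹ * a₂) (hi : i < n) :
    hLow q (q ^ n) i * diagA q a₁ a₂ b₁ b₂ Λ n (i + 1) =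
      diagA q a₁ a₂ b₁ b₂ Λ n i * gLow q (q ^ n) (a₂ * b₂) (a₁ * b₁) Λ τ i := by
  obtain ⟨m, rfl⟩ := Nat.exists_eq_add_of_lt hi
  have e₁ : q ^ (((i + 1 : ℕ) : ℤ) - 1) = q ^ i := by push_cast; simp
  have e₂ : a₂ * b₂ * Λ * q ^ ((i : ℤ) - 1) = a₂ * b₂ * Λ * q ^ i / q := by
    rw [zpow_sub_one₀ hq, zpow_natCast]; ring
  have e₃ : Λ * a₁ * a₂ * b₁ * b₂ * q ^ (((i + m + 1 : ℕ) : ℤ) + (i + 1 : ℕ) - 1) =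
      Λ * a₁ * a₂ * b₁ * b₂ * q ^ (2 * i + m) * q := by
    rw [mul_assoc _ (q ^ _) q, ← pow_succ, ← zpow_natCast]; congr 2; push_cast; ring
  have e₄ : q ^ (((i + m + 1 : ℕ) : ℤ) + i - 1) = q ^ (2 * i + m) := by
    rw [← zpow_natCast]; congr 1; push_cast; ring
  have hP : qPoch q (Λ * a₁ * a₂ * b₁ * b₂ * q ^ (2 * i + m) * q) m ≠ 0 :=
    qPoch_ne_zero fun k _ => by
      have := ht (2 * i + m + 1 + k : ℕ)
      rw [zpow_natCast] at this
      convert this using 2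
      ring
  have hR : qPoch q (a₂ * b₂ * Λ * q ^ i / q) i ≠ 0 := qPoch_ne_zero fun k _ => by
    have := hs (i - 1 + k)
    rw [zpow_add₀ hq, zpow_sub_one₀ hq, zpow_natCast, zpow_natCast] at this
    convert this using 2
    ring
  have hT : 1 - Λ * a₁ * a₂ * b₁ * b₂ * q ^ (2 * i + m) ≠ 0 := by
    exact_mod_cast ht (2 * i + m : ℕ)
  have hT' : 1 - a₂ * b₂ * Λ * (a₁ * b₁) * (q ^ (i + m + 1) / q) * q ^ i =
      1 - Λ * a₁ * a₂ * b₁ * b₂ * q ^ (2 * i + m) := by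
    field_simp
    ring
  have h₁ : 1 - a₂ * b₂ * Λ * q ^ (2 * i) / q ≠ 0 := by
    have := hs (2 * i - 1 : ℤ)
    rwa [zpow_sub_one₀ hq, show (2 * (i : ℤ)) = (2 * i : ℕ) by simp, zpow_natCast,
      ← div_eq_mul_inv, ← mul_div_assoc] at this
  have h₂ : 1 - a₂ * b₂ * Λ * q ^ (2 * i) ≠ 0 := by exact_mod_cast hs (2 * i : ℕ)
  have h₃ : 1 - a₂ * b₂ * Λ * q ^ (2 * i + 1) ≠ 0 := by exact_mod_cast hs (2 * i + 1 : ℕ)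
  have h₄ : 1 - a₂ * b₂ * Λ * q ^ i / q ≠ 0 := by
    have := hs (i - 1)
    rwa [zpow_sub_one₀ hq, zpow_natCast, ← div_eq_mul_inv, ← mul_div_assoc] at this
  rw [diagA, diagA, gLow, hLow, hT', show Λ * a₂ * b₂ = a₂ * b₂ * Λ by ring,
    show i + m + 1 - (i + 1) = m by omega, show i + m + 1 - i = m + 1 by omega, e₁, e₂, e₃, e₄,
    qPoch_zpow_pred_succ hq hs, qPoch_sq_succ hs, qPoch_succ_left q (_ * q ^ (2 * i + m)),
    C2_succ, C2_succ, qPoch_succ q Λ]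
  have hN : q ^ (i + m + 1) / q ^ (i + 1) = q ^ m := by field_simp; ring
  rw [hN]
  replace hτ : q ^ (i + m + 1) / q * τ * q ^ i * (a₂ * b₂ - a₂ * b₂ * Λ * q ^ i) =
      a₂ / a₁ * q ^ i * (1 - Λ * q ^ i) := by
    linear_combination q ^ i * (1 - Λ * q ^ i) * hτ
  rw [hτ]
  have hY := pow_ne_zero i hq
  rw [show q ^ (C2 i + i + C2 m) = q ^ (C2 i + C2 m) * q ^ i by ring,
    show q ^ (C2 i + (C2 m + m)) = q ^ (C2 i + C2 m) * q ^ m by ring, pow_succ a₁, pow_succ a₂]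
  generalize 1 - Λ * a₁ * a₂ * b₁ * b₂ * q ^ (2 * i + m) = t at *
  generalize qPoch q (Λ * a₁ * a₂ * b₁ * b₂ * q ^ (2 * i + m) * q) m = P at *
  generalize qPoch q (a₂ * b₂ * Λ * q ^ i / q) i = R at *
  generalize 1 - a₂ * b₂ * Λ * q ^ (2 * i) / q = d₁ at *
  generalize 1 - a₂ * b₂ * Λ * q ^ (2 * i) = d₂ at *
  generalize 1 - a₂ * b₂ * Λ * q ^ (2 * i + 1) = d₃ at *
  generalize 1 - a₂ * b₂ * Λ * q ^ i / q = d₄ at *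
  field_simp

theorem hLow_mul_diagR_succ {i : ℕ} {σ : F} (hq : q ≠ 0) (ha₁ : a₁ ≠ 0) (ha₂ : a₂ ≠ 0)
    (hs : ∀ k : ℤ, 1 - a₂ * b₂ * σ * q ^ k ≠ 0) (hb : ∀ k : ℕ, 1 - a₁ * b₂ * q ^ k ≠ 0)
    (hσ : a₂ * b₂ * σ = a₁⁻¹ * a₂ * (q / q ^ n)) (hi : i < n) :
    hLow q (q ^ n) i * (diagR q a₁ a₂ b₁ b₂ n (i + 1) * (Λ * (q ^ n / q)) ^ (i + 1)) =
      diagR q a₁ a₂ b₁ b₂ n i * (Λ * (q ^ n / q)) ^ i *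
        gLow q (q ^ n) (a₂ * b₂) (a₁ * b₁) σ Λ i := by
  obtain ⟨m, rfl⟩ := Nat.exists_eq_add_of_lt hi
  have hX := pow_ne_zero m hq
  have hY := pow_ne_zero i hq
  have hN : q ^ (i + m + 1) = q ^ i * q ^ m * q := by ring
  have e₁ : a₁⁻¹ * a₂ * q ^ (-(((i + m + 1 : ℕ) : ℤ) - (i + 1 : ℕ))) =
      a₂ * b₂ * σ * q ^ i := by
    rw [hσ, show -(((i + m + 1 : ℕ) : ℤ) - (i + 1 : ℕ)) = -m by push_cast; ring, zpow_neg,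
      zpow_natCast, hN]
    field_simp
  have e₂ : a₁⁻¹ * a₂ * q ^ (-(((i + m + 1 : ℕ) : ℤ) - i)) = a₂ * b₂ * σ * q ^ i / q := by
    rw [hσ, show -(((i + m + 1 : ℕ) : ℤ) - i) = -(m + 1 : ℕ) by push_cast; ring, zpow_neg,
      zpow_natCast, hN, pow_succ]
    field_simp
  have e₃ : a₁ * a₂⁻¹ * q ^ (-((i + 1 : ℕ) : ℤ)) =
      (a₂ * b₂ * σ * q ^ (i + m + 1) * q ^ i)⁻¹ := by
    rw [hσ, zpow_neg, zpow_natCast, hN, pow_succ]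
    field_simp
  have e₄ : a₁ * a₂⁻¹ * q ^ (-(i : ℤ)) = (a₂ * b₂ * σ * q ^ (i + m + 1) * q ^ i)⁻¹ * q := by
    rw [hσ, zpow_neg, zpow_natCast, hN]
    field_simp
  have hv : 1 - a₂ * b₂ * σ * (a₁ * b₁) * (q ^ (i + m + 1) / q) * q ^ i =
      1 - a₂ * b₁ * q ^ i := by
    rw [hσ, hN]
    field_simp
  have hs₀ : a₂ * b₂ * σ ≠ 0 := by
    rw [hσ]
    positivity
  have hu : a₂ * b₂ - a₂ * b₂ * σ * q ^ i =
      -(a₂ * b₂ * σ * q ^ i) * (1 - a₁ * b₂ * q ^ m) := by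
    rw [neg_mul, mul_sub, hσ, hN]
    field_simp
    ring
  have hu₀ := hb m
  have h₁ : 1 - a₂ * b₂ * σ * q ^ (2 * i) / q ≠ 0 := by
    have := hs (2 * i - 1 : ℤ)
    rwa [zpow_sub_one₀ hq, show (2 * (i : ℤ)) = (2 * i : ℕ) by simp, zpow_natCast,
      ← div_eq_mul_inv, ← mul_div_assoc] at this
  have h₂ : 1 - a₂ * b₂ * σ * q ^ (2 * i) ≠ 0 := by exact_mod_cast hs (2 * i : ℕ)
  have h₃ : 1 - a₂ * b₂ * σ * q ^ (2 * i + 1) ≠ 0 := by exact_mod_cast hs (2 * i + 1 : ℕ)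
  have h₄ : 1 - a₂ * b₂ * σ * q ^ i / q ≠ 0 := by
    have := hs (i - 1)
    rwa [zpow_sub_one₀ hq, zpow_natCast, ← div_eq_mul_inv, ← mul_div_assoc] at this
  have hB : qPoch q (a₁ * b₂) m ≠ 0 := qPoch_ne_zero fun k _ => hb k
  have hR : qPoch q (a₂ * b₂ * σ * q ^ i / q) i ≠ 0 := qPoch_ne_zero fun k _ => by
    have := hs (i - 1 + k)
    rw [zpow_add₀ hq, zpow_sub_one₀ hq, zpow_natCast, zpow_natCast] at this
    convert this using 2
    ring
  have hP : qPoch q (a₂ * b₂ * σ * q ^ (i + m + 1) * q ^ i)⁻¹ m =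
      -(qPoch q ((a₂ * b₂ * σ * q ^ (i + m + 1) * q ^ i)⁻¹ * q) (m + 1) *
        (1 - a₂ * b₂ * σ * q ^ (i + m + 1) * q ^ i) * (a₂ * b₂ * σ * q ^ i * q ^ i) /
          (q ^ m * ((1 - a₂ * b₂ * σ * q ^ (2 * i)) * (1 - a₂ * b₂ * σ * q ^ (2 * i + 1))))) := by
    have := qPoch_shift q (a₂ * b₂ * σ * q ^ (i + m + 1) * q ^ i)⁻¹ (m + 1)
    rw [qPoch_succ q _⁻¹] at this
    generalize qPoch q ((a₂ * b₂ * σ * q ^ (i + m + 1) * q ^ i)⁻¹ * q) (m + 1) = P₁ at *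
    generalize qPoch q (a₂ * b₂ * σ * q ^ (i + m + 1) * q ^ i)⁻¹ m = P₂ at *
    generalize a₂ * b₂ * σ = s at *
    rw [← neg_div, eq_div_iff (mul_ne_zero hX (mul_ne_zero h₂ h₃))]
    rw [hN, pow_succ q m] at *
    field_simp at this
    linear_combination -this
  rw [diagR, diagR, gLow, hLow, hv, hu, show i + m + 1 - (i + 1) = m by omega,
    show i + m + 1 - i = m + 1 by omega, e₁, e₂, e₃, e₄, hP,
    qPoch_zpow_pred_succ hq hs, qPoch_succ q (a₂ * b₁), qPoch_succ q (a₁ * b₂),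
    pow_succ (Λ * _)]
  have hN' : q ^ (i + m + 1) / q ^ (i + 1) = q ^ m := by field_simp; ring
  have hN'' : q ^ (i + m + 1) / q = q ^ m * q ^ i := by field_simp; ring
  rw [hN', hN'']
  generalize (Λ * (q ^ m * q ^ i)) ^ i = x
  generalize qPoch q ((a₂ * b₂ * σ * q ^ (i + m + 1) * q ^ i)⁻¹ * q) (m + 1) = P₁ at *
  generalize 1 - a₂ * b₂ * σ * q ^ (i + m + 1) * q ^ i = d₅ at *
  generalize qPoch q (a₂ * b₂ * σ * q ^ i / q) i = R at *
  generalize 1 - a₂ * b₂ * σ * q ^ (2 * i) / q = d₁ at *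
  generalize 1 - a₂ * b₂ * σ * q ^ (2 * i) = d₂ at *
  generalize 1 - a₂ * b₂ * σ * q ^ (2 * i + 1) = d₃ at *
  generalize 1 - a₂ * b₂ * σ * q ^ i / q = d₄ at *
  generalize 1 - a₁ * b₂ * q ^ m = d₆ at *
  field_simp

end DiagonalRatios

section Commutation

open Matrix

variable {F : Type*} [Field F] {q a₁ a₂ b₁ b₂ Λ : F} {n : ℕ}

theorem matDA_eq : matDA q a₁ a₂ b₁ b₂ Λ n =
    diagonal fun j : Fin (n + 1) => diagA q a₁ a₂ b₁ b₂ Λ n j := rfl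

theorem matDR_eq : matDR q a₁ a₂ b₁ b₂ n =
    diagonal fun j : Fin (n + 1) => diagR q a₁ a₂ b₁ b₂ n j := rfl

theorem upperScale_mul_pow (q v x y : F) (n j : ℕ) :
    upperScale q v x n j * y ^ j = upperScale q v (x * y) n j := by
  simp only [upperScale, mul_pow]
  ring

theorem mul_div_eq_div_mul_of_ratios {a b c D D' E E' : F} (ha : a ≠ 0) (hE : E ≠ 0) (hE' : E' ≠ 0)
    (h : a * E' = E * b) (h' : a * D' = D * c) : b * (D' / E') = D / E * c := by
  rw [mul_div_assoc', div_mul_eq_mul_div, div_eq_div_iff hE' hE]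
  refine mul_left_cancel₀ ha ?_
  linear_combination b * E * h' - D * c * h

/-- Collecting the diagonal factors of a product of triangular factorizations. -/
theorem symmetrized_of_triangular {ι : Type*} [Fintype ι] [DecidableEq ι] {K : Matrix ι ι F}
    (α β D γ δ : ι → F) :
    diagonal α * K * diagonal β * diagonal D * (diagonal γ * Kᵀ * diagonal δ) =
      diagonal α * (K * diagonal (fun i => β i * D i * γ i) * Kᵀ) * diagonal δ := by
  rw [← diagonal_mul_diagonal (fun i => β i * D i), ← diagonal_mul_diagonal]
  simp only [Matrix.mul_assoc]

theorem commute_ito (hq : q ≠ 0) (ha₁ : a₁ ≠ 0) (ha₂ : a₂ ≠ 0) (hb₂ : b₂ ≠ 0) (hΛ : Λ ≠ 0)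
    (hq' : ∀ k : ℕ, 1 - q ^ (k + 1) ≠ 0) (hu : ∀ k : ℕ, 1 - a₂ * b₂ * q ^ k ≠ 0)
    (hv : ∀ k : ℕ, 1 - a₁ * b₁ * q ^ k ≠ 0) (hb : ∀ k : ℕ, 1 - a₁ * b₂ * q ^ k ≠ 0)
    (hs : ∀ k : ℤ, 1 - a₂ * b₂ * Λ * q ^ k ≠ 0) (hc : ∀ k : ℤ, 1 - a₁⁻¹ * a₂ * q ^ k ≠ 0)
    (ht : ∀ k : ℤ, 1 - Λ * a₁ * a₂ * b₁ * b₂ * q ^ k ≠ 0) :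
    Commute
      (matLR q a₁ a₂ b₁ b₂ n * matDR q a₁ a₂ b₁ b₂ n * matUR q a₁ a₂ b₁ b₂ n *
        diagonal fun i : Fin (n + 1) => (Λ * (q ^ n / q)) ^ (i : ℕ))
      (matLA q a₁ a₂ b₁ b₂ Λ n * matDA q a₁ a₂ b₁ b₂ Λ n * matUA q a₁ a₂ b₁ b₂ Λ n) := by
  obtain ⟨σ, hσ⟩ : ∃ σ, a₂ * b₂ * σ = a₁⁻¹ * a₂ * (q / q ^ n) :=
    ⟨(a₂ * b₂)⁻¹ * (a₁⁻¹ * a₂ * (q / q ^ n)), mul_inv_cancel_left₀ (mul_ne_zero ha₂ hb₂) _⟩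
  have hc₀ : a₁⁻¹ * a₂ ≠ 0 := mul_ne_zero (inv_ne_zero ha₁) ha₂
  have hs₀ : a₂ * b₂ * σ ≠ 0 := by
    rw [hσ]
    exact mul_ne_zero hc₀ (div_ne_zero hq (pow_ne_zero n hq))
  have hσ' : q ^ n / q * (a₂ * b₂ * σ) = a₁⁻¹ * a₂ := by
    rw [hσ]
    field_simp
  have hsσ : ∀ k : ℤ, 1 - a₂ * b₂ * σ * q ^ k ≠ 0 := fun k => by
    have := hc (1 - n + k)
    rwa [zpow_add₀ hq, zpow_sub₀ hq, zpow_one, zpow_natCast, ← mul_assoc, ← hσ] at this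
  have hqP : ∀ k, qPoch q q k ≠ 0 := fun k => qPoch_ne_zero fun i _ => by
    rw [← pow_succ']
    exact hq' i
  have huP : ∀ k, qPoch q (a₂ * b₂) k ≠ 0 := fun k => qPoch_ne_zero fun i _ => hu i
  have hvP : ∀ k, qPoch q (a₁ * b₁) k ≠ 0 := fun k => qPoch_ne_zero fun i _ => hv i
  set α : ℕ → F := lowerScale q (a₂ * b₂) n with hα
  set δ : ℕ → F := upperScale q (a₁ * b₁) (-(Λ * a₁⁻¹ * a₂)) n with hδ
  have hx : -(q ^ n / q * (a₂ * b₂ * σ * Λ)) = -(Λ * a₁⁻¹ * a₂) := by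
    linear_combination -Λ * hσ'
  have hα₀ : ∀ i, α i ≠ 0 := fun i => div_ne_zero (mul_ne_zero (mul_ne_zero
    (pow_ne_zero _ (neg_ne_zero.2 one_ne_zero)) (pow_ne_zero _ hq)) (huP _)) (hqP _)
  have hδ₀ : ∀ i, δ i ≠ 0 := fun i => div_ne_zero (mul_ne_zero (mul_ne_zero
    (pow_ne_zero _ (neg_ne_zero.2 (mul_ne_zero (mul_ne_zero hΛ (inv_ne_zero ha₁)) ha₂)))
      (pow_ne_zero _ hq)) (hqP _)) (hvP _)
  have hE : ∀ i < n, hLow q (q ^ n) i * (δ (i + 1) * α (i + 1)) =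
      δ i * α i * hUp q (q ^ n) (a₂ * b₂) (a₁ * b₁) σ Λ i := fun i hi => by
    have := hLow_mul_scale_succ (u := a₂ * b₂) (σ := σ) (τ := Λ) hq hqP hvP hi
    rwa [hx] at this
  have hL : ∀ i, hLow q (q ^ n) i ≠ 0 := fun i =>
    neg_ne_zero.2 (div_ne_zero (pow_ne_zero _ hq) (pow_ne_zero _ hq))
  have hδσ : ∀ j, upperScale q (a₁ * b₁) (-(a₂ * b₂ * σ)) n j * (Λ * (q ^ n / q)) ^ j = δ j :=
    fun j => by
      rw [upperScale_mul_pow, hδ, ← hx]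
      congr 1
      ring
  have key := commute_of_symmetrized (α := α) (δ := δ)
    (D := fun i => diagR q a₁ a₂ b₁ b₂ n i * (Λ * (q ^ n / q)) ^ i / (δ i * α i))
    (D' := fun i => diagA q a₁ a₂ b₁ b₂ Λ n i / (δ i * α i))
    hq hq' hsσ hs (fun i _ => hα₀ i) (fun i _ => hδ₀ i)
    (fun i hi => mul_div_eq_div_mul_of_ratios (hL i) (mul_ne_zero (hδ₀ _) (hα₀ _))
      (mul_ne_zero (hδ₀ _) (hα₀ _)) (hE i hi) (hLow_mul_diagR_succ hq ha₁ ha₂ hsσ hb hσ hi))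
    (fun i hi => by
      rw [hUp_comm]
      exact mul_div_eq_div_mul_of_ratios (hL i) (mul_ne_zero (hδ₀ _) (hα₀ _))
        (mul_ne_zero (hδ₀ _) (hα₀ _)) (hE i hi) (hLow_mul_diagA_succ hq ha₁ hs ht hσ' hi)) hE
  have hR : matLR q a₁ a₂ b₁ b₂ n * matDR q a₁ a₂ b₁ b₂ n * matUR q a₁ a₂ b₁ b₂ n *
      (diagonal fun i : Fin (n + 1) => (Λ * (q ^ n / q)) ^ (i : ℕ)) =
      diagonal (fun i : Fin (n + 1) => α i) * (qKernelMatrix n q (a₂ * b₂ * σ) *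
        diagonal (fun i : Fin (n + 1) =>
          diagR q a₁ a₂ b₁ b₂ n i * (Λ * (q ^ n / q)) ^ (i : ℕ) / (δ i * α i)) *
        (qKernelMatrix n q (a₂ * b₂ * σ))ᵀ) * diagonal (fun i : Fin (n + 1) => δ i) := by
    rw [matLR_eq hq hqP huP hσ, matDR_eq, matUR_eq hq hc₀ hqP hvP hσ,
      symmetrized_of_triangular, Matrix.mul_assoc _ (diagonal _) (diagonal _),
      diagonal_mul_diagonal]
    simp only [hδσ]
    congr! 5
    ext i
    have h := hδ₀ i
    rw [← hδσ i] at h ⊢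
    have h₁ := left_ne_zero_of_mul h
    have h₂ := right_ne_zero_of_mul h
    have h₃ := hα₀ i
    rw [← hα]
    generalize (Λ * (q ^ n / q)) ^ (i : ℕ) = y at *
    field_simp
  have hA : matLA q a₁ a₂ b₁ b₂ Λ n * matDA q a₁ a₂ b₁ b₂ Λ n * matUA q a₁ a₂ b₁ b₂ Λ n =
      diagonal (fun i : Fin (n + 1) => α i) * (qKernelMatrix n q (a₂ * b₂ * Λ) *
        diagonal (fun i : Fin (n + 1) => diagA q a₁ a₂ b₁ b₂ Λ n i / (δ i * α i)) *
        (qKernelMatrix n q (a₂ * b₂ * Λ))ᵀ) * diagonal (fun i : Fin (n + 1) => δ i) := by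
    rw [matLA_eq hq hqP huP, matDA_eq,
      matUA_eq hq (mul_ne_zero (mul_ne_zero hΛ (inv_ne_zero ha₁)) ha₂) hqP hvP,
      symmetrized_of_triangular]
    congr! 5
    ext i
    rw [div_eq_mul_inv, mul_inv]
    ring
  rw [hR, hA]
  exact key

theorem one_sub_mul_zpow_ne_zero {a : F} (hq : q ≠ 0) (h : ∀ k : ℕ, 1 - a * q ^ k ≠ 0)
    (h' : ∀ k : ℕ, q ^ k - a ≠ 0) (k : ℤ) : 1 - a * q ^ k ≠ 0 := by
  obtain ⟨m, rfl | rfl⟩ := k.eq_nat_or_neg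
  · exact_mod_cast h m
  · have hm := pow_ne_zero m hq
    rw [_root_.zpow_neg, zpow_natCast, ← div_eq_mul_inv, one_sub_div hm]
    exact div_ne_zero (h' m) hm

end Commutation

theorem algebraMap_ne_zero_of_eval (f : Fin 6 → ℚ) {p : MvPolynomial (Fin 6) ℚ}
    (h : MvPolynomial.eval f p ≠ 0) : algebraMap (MvPolynomial (Fin 6) ℚ) F7 p ≠ 0 := by
  rw [Ne, FaithfulSMul.algebraMap_eq_zero_iff]
  rintro rfl
  exact h (map_zero _)

/-- Theorem D.1: with `R = L_R D_R U_R`, `A = L_A D_A U_A` and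
`D₂ = diag((Λq^{n-1})^i)`, one has `R D₂ A = A R D₂`. -/
theorem statement7
    (q a₁ a₂ b₁ b₂ Λ : F7)
    (hq : q = algebraMap (MvPolynomial (Fin 6) ℚ) F7 (MvPolynomial.X 0))
    (ha₁ : a₁ = algebraMap (MvPolynomial (Fin 6) ℚ) F7 (MvPolynomial.X 1))
    (ha₂ : a₂ = algebraMap (MvPolynomial (Fin 6) ℚ) F7 (MvPolynomial.X 2))
    (hb₁ : b₁ = algebraMap (MvPolynomial (Fin 6) ℚ) F7 (MvPolynomial.X 3))
    (hb₂ : b₂ = algebraMap (MvPolynomial (Fin 6) ℚ) F7 (MvPolynomial.X 4))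
    (hΛ : Λ = algebraMap (MvPolynomial (Fin 6) ℚ) F7 (MvPolynomial.X 5))
    (n : ℕ) :
    (matLR q a₁ a₂ b₁ b₂ n * matDR q a₁ a₂ b₁ b₂ n * matUR q a₁ a₂ b₁ b₂ n) *
        (Matrix.diagonal fun i : Fin (n + 1) => (Λ * q ^ ((n : ℤ) - 1)) ^ (i : ℕ)) *
        (matLA q a₁ a₂ b₁ b₂ Λ n * matDA q a₁ a₂ b₁ b₂ Λ n * matUA q a₁ a₂ b₁ b₂ Λ n) =
      (matLA q a₁ a₂ b₁ b₂ Λ n * matDA q a₁ a₂ b₁ b₂ Λ n * matUA q a₁ a₂ b₁ b₂ Λ n) *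
        (matLR q a₁ a₂ b₁ b₂ n * matDR q a₁ a₂ b₁ b₂ n * matUR q a₁ a₂ b₁ b₂ n) *
        (Matrix.diagonal fun i : Fin (n + 1) => (Λ * q ^ ((n : ℤ) - 1)) ^ (i : ℕ)) := by
  have hX : ∀ i, algebraMap (MvPolynomial (Fin 6) ℚ) F7 (MvPolynomial.X i) ≠ 0 := fun i =>
    algebraMap_ne_zero_of_eval 1 (by simp)
  have hq₀ : q ≠ 0 := hq ▸ hX 0
  have ha₁₀ : a₁ ≠ 0 := ha₁ ▸ hX 1
  have hq' : ∀ k : ℕ, 1 - q ^ (k + 1) ≠ 0 := fun k => by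
    have := algebraMap_ne_zero_of_eval 2 (p := 1 - MvPolynomial.X 0 ^ (k + 1)) (by
      simpa using (sub_neg.2 (one_lt_pow₀ one_lt_two k.succ_ne_zero : (1 : ℚ) < _)).ne)
    simpa [hq] using this
  have key : ∀ p r : MvPolynomial (Fin 6) ℚ,
      MvPolynomial.eval ![1, 2, 3, 5, 7, 11] p ≠ MvPolynomial.eval ![1, 2, 3, 5, 7, 11] r →
      ∀ k : ℕ, algebraMap (MvPolynomial (Fin 6) ℚ) F7 p -
        algebraMap (MvPolynomial (Fin 6) ℚ) F7 r * q ^ k ≠ 0 := fun p r h k => by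
    have := algebraMap_ne_zero_of_eval ![1, 2, 3, 5, 7, 11] (p := p - r * MvPolynomial.X 0 ^ k)
      (by simpa [sub_eq_zero] using h)
    simpa [hq] using this
  have hzpow : ∀ r : MvPolynomial (Fin 6) ℚ, MvPolynomial.eval ![1, 2, 3, 5, 7, 11] r ≠ 1 →
      ∀ k : ℤ, 1 - algebraMap (MvPolynomial (Fin 6) ℚ) F7 r * q ^ k ≠ 0 := fun r h =>
    one_sub_mul_zpow_ne_zero hq₀ (fun k => by simpa using key 1 r (by simpa using h.symm) k)
      fun k => by
        rw [← neg_ne_zero, neg_sub]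
        simpa using key r 1 (by simpa using h) k
  have hu : ∀ k : ℤ, 1 - a₂ * b₂ * q ^ k ≠ 0 := by
    have := hzpow (MvPolynomial.X 2 * MvPolynomial.X 4) (by simp; norm_num)
    simpa only [map_mul, ← ha₂, ← hb₂] using this
  have hv : ∀ k : ℤ, 1 - a₁ * b₁ * q ^ k ≠ 0 := by
    have := hzpow (MvPolynomial.X 1 * MvPolynomial.X 3) (by simp; norm_num)
    simpa only [map_mul, ← ha₁, ← hb₁] using this
  have hb : ∀ k : ℤ, 1 - a₁ * b₂ * q ^ k ≠ 0 := by
    have := hzpow (MvPolynomial.X 1 * MvPolynomial.X 4) (by simp; norm_num)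
    simpa only [map_mul, ← ha₁, ← hb₂] using this
  have hs : ∀ k : ℤ, 1 - a₂ * b₂ * Λ * q ^ k ≠ 0 := by
    have := hzpow (MvPolynomial.X 2 * MvPolynomial.X 4 * MvPolynomial.X 5) (by simp; norm_num)
    simpa only [map_mul, ← ha₂, ← hb₂, ← hΛ] using this
  have ht : ∀ k : ℤ, 1 - Λ * a₁ * a₂ * b₁ * b₂ * q ^ k ≠ 0 := by
    have := hzpow (MvPolynomial.X 5 * MvPolynomial.X 1 * MvPolynomial.X 2 * MvPolynomial.X 3 *
      MvPolynomial.X 4) (by simp; norm_num)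
    simpa only [map_mul, ← ha₁, ← ha₂, ← hb₁, ← hb₂, ← hΛ] using this
  have hc : ∀ k : ℤ, 1 - a₁⁻¹ * a₂ * q ^ k ≠ 0 := by
    refine one_sub_mul_zpow_ne_zero hq₀ (fun k h => ?_) (fun k h => ?_)
    · have := key (MvPolynomial.X 1) (MvPolynomial.X 2) (by simp) k
      rw [← ha₁, ← ha₂] at this
      refine this ?_
      field_simp at h
      simpa using h
    · have := key (MvPolynomial.X 2) (MvPolynomial.X 1) (by simp) k
      rw [← ha₁, ← ha₂] at this
      refine this ?_
      field_simp at h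
      linear_combination -h
  have hzn : q ^ ((n : ℤ) - 1) = q ^ n / q := by
    rw [zpow_sub_one₀ hq₀, zpow_natCast, div_eq_mul_inv]
  rw [hzn, Matrix.mul_assoc (_ * _ * _) (_ * _ * _) (Matrix.diagonal _)]
  exact (commute_ito hq₀ ha₁₀ (ha₂ ▸ hX 2) (hb₂ ▸ hX 4) (hΛ ▸ hX 5) hq'
    (fun k => by exact_mod_cast hu k) (fun k => by exact_mod_cast hv k)
    (fun k => by exact_mod_cast hb k) hs hc ht).eq
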